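/- arXiv:2603.21379 — 4 statements merged into one kernel-verified Lean document; each statement's English description precedes it below -/
import Mathlib

section
/- Let m, n, r be positive integers with r ≤ n ≤ m. Let V₁ ∈ ℝ^{m×r} and V₂ ∈ ℝ^{m×(n−r)} each have orthonormal columns (these are the blocks of the right singular-vector matrix V = [V₁ V₂] of an n×m matrix). Set M₁ = m·μ(V₁) and M₂ = m·μ(V₂). Let the sampling matrix E ∈ ℝ^{m×s} be obtained by choosing s column indices uniformly at random without replacement from {1,…,m} and taking the corresponding canonical basis vectors of ℝ^m as the columns of E. Suppose s ≥ max{α₁ M₁ log r, α₂ M₂ log(n−r)} for some α₁, α₂ ≥ 0. Then for every δ ∈ [0,1) and η ∈ [0, m/s − 1], the probability that either σ_r(V₁ᵀE) < √((1−δ)s/m) or σ₁(V₂ᵀE) > √((1+η)s/m) is at most r·(e^{−δ}/(1−δ)^{1−δ})^{α₁ log r} + (n−r)·(e^{η}/(1+η)^{1+η})^{α₂ log (n−r)}. -/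
open Matrix

/-- The eigenvalues of the real symmetric matrix `M * Mᴴ`; their square roots are
the singular values of `M`. -/
noncomputable def gramEigs {ι κ : Type*} [Fintype ι] [DecidableEq ι] [Fintype κ]
    (M : Matrix ι κ ℝ) : ι → ℝ :=
  (Matrix.isHermitian_mul_conjTranspose_self M).eigenvalues

/-- The coherence `μ(V) = max_i ∑_j V_{ij}²` of a matrix `V` with orthonormal columns. -/
noncomputable def coherence {m q : ℕ} (V : Matrix (Fin m) (Fin q) ℝ) : ℝ :=
  ⨆ i : Fin m, ∑ j, V i j ^ 2

/-- The sampling matrix whose columns are the canonical basis vectors of `ℝ^m` indexed by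
the subset `A ⊆ {1,…,m}` (columns indexed by the elements of `A`). -/
def samplingOf {m : ℕ} (A : Finset (Fin m)) : Matrix (Fin m) A ℝ :=
  Matrix.of fun i a => if i = (a : Fin m) then (1 : ℝ) else 0


lemma ch_logmean_aux (u : ℝ) (hu : 0 ≤ u) : 0 ≤ (u - 2) * Real.exp u + u + 2 := by
  have hd : ∀ x : ℝ, HasDerivAt (fun u : ℝ => (u - 2) * Real.exp u + u + 2)
      (1 * Real.exp x + (x - 2) * Real.exp x + 1) x := by
    intro x
    exact ((((hasDerivAt_id x).sub_const 2).mul (Real.hasDerivAt_exp x)).add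
      (hasDerivAt_id x)).add_const 2
  have hm : MonotoneOn (fun u : ℝ => (u - 2) * Real.exp u + u + 2) (Set.Ici 0) := by
    apply monotoneOn_of_deriv_nonneg (convex_Ici 0)
    · exact fun x _ => (hd x).continuousAt.continuousWithinAt
    · exact fun x _ => (hd x).differentiableAt.differentiableWithinAt
    · intro x _
      rw [(hd x).deriv]
      have h1 := Real.add_one_le_exp (-x)
      have h2 := Real.exp_pos x
      have h3 : Real.exp (-x) * Real.exp x = 1 := by rw [← Real.exp_add]; simp
      nlinarith
  have := hm (Set.mem_Ici.2 le_rfl) (Set.mem_Ici.2 hu) hu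
  simp at this
  linarith

lemma ch_logmean (a b : ℝ) (h : a ≤ b) :
    Real.exp b - Real.exp a ≤ (b - a) * ((Real.exp a + Real.exp b) / 2) := by
  have h1 := ch_logmean_aux (b - a) (by linarith)
  have h2 := Real.exp_pos a
  have h3 : Real.exp b = Real.exp a * Real.exp (b - a) := by rw [← Real.exp_add]; ring_nf
  rw [h3]
  nlinarith

/-- squared form: multiply by `b - a`. -/
lemma ch_logmean_sq (a b : ℝ) :
    (Real.exp b - Real.exp a) * (b - a) ≤ (b - a) ^ 2 * ((Real.exp a + Real.exp b) / 2) := by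
  rcases le_total a b with h | h
  · have := ch_logmean a b h
    nlinarith
  · have := ch_logmean b a h
    nlinarith

lemma ch_exp_sub_le (a b : ℝ) : Real.exp b - Real.exp a ≤ (b - a) * Real.exp b := by
  have h1 := Real.add_one_le_exp (a - b)
  have h2 := Real.exp_pos b
  have h3 : Real.exp a = Real.exp b * Real.exp (a - b) := by rw [← Real.exp_add]; ring_nf
  rw [h3]; nlinarith

lemma ch_exp_mono (a b : ℝ) : 0 ≤ (b - a) * (Real.exp b - Real.exp a) := by
  rcases le_total a b with h | h
  · exact mul_nonneg (by linarith) (by linarith [Real.exp_le_exp.2 h])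
  · exact mul_nonneg_of_nonpos_of_nonpos (by linarith) (by linarith [Real.exp_le_exp.2 h])

section abs
variable {d : ℕ}


lemma ch_parseval (p : OrthonormalBasis (Fin d) ℝ (EuclideanSpace ℝ (Fin d)))
    (x y : EuclideanSpace ℝ (Fin d)) :
    ∑ i, inner ℝ (p i) x * inner ℝ (p i) y = inner ℝ x y := by
  rw [← p.sum_inner_mul_inner x y]
  refine Finset.sum_congr rfl fun i _ => ?_
  rw [real_inner_comm]

noncomputable def chG (θ : ℝ) (b : Fin d → ℝ)
    (q : OrthonormalBasis (Fin d) ℝ (EuclideanSpace ℝ (Fin d)))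
    (v : EuclideanSpace ℝ (Fin d)) : ℝ :=
  ∑ j, inner ℝ (q j) v ^ 2 * Real.exp (θ * b j)

/-- double-sum representation -/
lemma ch_G_left (θ : ℝ) (b : Fin d → ℝ)
    (p q : OrthonormalBasis (Fin d) ℝ (EuclideanSpace ℝ (Fin d)))
    (v : EuclideanSpace ℝ (Fin d)) :
    chG θ b q v = ∑ j, ∑ i, inner ℝ (q j) v * inner ℝ (p i) v * inner ℝ (q j) (p i)
      * Real.exp (θ * b j) := by
  unfold chG
  refine Finset.sum_congr rfl fun j _ => ?_
  rw [← Finset.sum_mul]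
  congr 1
  have := ch_parseval p (q j) v
  rw [sq]
  nth_rewrite 2 [← this]
  rw [Finset.mul_sum]
  refine Finset.sum_congr rfl fun i _ => ?_
  rw [real_inner_comm (q j) (p i)]; ring

lemma ch_G_right (θ : ℝ) (a : Fin d → ℝ)
    (p q : OrthonormalBasis (Fin d) ℝ (EuclideanSpace ℝ (Fin d)))
    (v : EuclideanSpace ℝ (Fin d)) :
    chG θ a p v = ∑ j, ∑ i, inner ℝ (q j) v * inner ℝ (p i) v * inner ℝ (q j) (p i)
      * Real.exp (θ * a i) := by
  rw [ch_G_left θ a q p v, Finset.sum_comm]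
  refine Finset.sum_congr rfl fun j _ => Finset.sum_congr rfl fun i _ => ?_
  rw [real_inner_comm (p i) (q j)]; ring

lemma ch_F_left (b : Fin d → ℝ)
    (p q : OrthonormalBasis (Fin d) ℝ (EuclideanSpace ℝ (Fin d))) :
    ∑ j, b j = ∑ j, ∑ i, inner ℝ (q j) (p i) ^ 2 * b j := by
  refine Finset.sum_congr rfl fun j _ => ?_
  rw [← Finset.sum_mul]
  have := ch_parseval p (q j) (q j)
  rw [real_inner_self_eq_norm_sq, q.norm_eq_one] at this
  have h2 : ∑ i, inner ℝ (q j) (p i) ^ 2 = (1:ℝ) := by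
    rw [one_pow] at this
    rw [← this]
    refine Finset.sum_congr rfl fun i _ => ?_
    rw [real_inner_comm (q j) (p i)]; ring
  rw [h2, one_mul]

lemma ch_F_right (a : Fin d → ℝ)
    (p q : OrthonormalBasis (Fin d) ℝ (EuclideanSpace ℝ (Fin d))) :
    ∑ i, a i = ∑ j, ∑ i, inner ℝ (q j) (p i) ^ 2 * a i := by
  rw [ch_F_left a q p, Finset.sum_comm]
  refine Finset.sum_congr rfl fun j _ => Finset.sum_congr rfl fun i _ => ?_
  rw [real_inner_comm (p i) (q j)]

lemma ch_F_step (θ h : ℝ) (a b : Fin d → ℝ)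
    (p q : OrthonormalBasis (Fin d) ℝ (EuclideanSpace ℝ (Fin d)))
    (v : EuclideanSpace ℝ (Fin d))
    (H : ∀ j i, h * (inner ℝ (q j) v * inner ℝ (p i) v) = (b j - a i) * inner ℝ (q j) (p i)) :
    ∑ j, Real.exp (θ * b j) - ∑ i, Real.exp (θ * a i) ≤ h * (θ * chG θ b q v) := by
  rw [ch_F_left (fun j => Real.exp (θ * b j)) p q, ch_F_right (fun j => Real.exp (θ * a j)) p q,
    ch_G_left θ b p q v, Finset.mul_sum, Finset.mul_sum, ← Finset.sum_sub_distrib]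
  refine Finset.sum_le_sum fun j _ => ?_
  rw [Finset.mul_sum, Finset.mul_sum, ← Finset.sum_sub_distrib]
  refine Finset.sum_le_sum fun i _ => ?_
  have h1 := ch_exp_sub_le (θ * a i) (θ * b j)
  have h2 := mul_le_mul_of_nonneg_left h1 (sq_nonneg (inner ℝ (q j) (p i)))
  have h3 := H j i
  calc _ = inner ℝ (q j) (p i) ^ 2 * (Real.exp (θ * b j) - Real.exp (θ * a i)) := by ring
    _ ≤ _ := h2
    _ = θ * ((b j - a i) * inner ℝ (q j) (p i)) * inner ℝ (q j) (p i) * Real.exp (θ * b j) := by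
      ring
    _ = _ := by rw [← h3]; ring

lemma ch_G_step (θ h M : ℝ) (hh : 0 < h) (a b : Fin d → ℝ)
    (p q : OrthonormalBasis (Fin d) ℝ (EuclideanSpace ℝ (Fin d)))
    (v : EuclideanSpace ℝ (Fin d)) (hM : inner ℝ v v ≤ M)
    (H : ∀ j i, h * (inner ℝ (q j) v * inner ℝ (p i) v) = (b j - a i) * inner ℝ (q j) (p i)) :
    (1 - θ * h * M / 2) * (θ * chG θ b q v) ≤ (1 + θ * h * M / 2) * (θ * chG θ a p v) := by
  have hGa : 0 ≤ chG θ a p v := Finset.sum_nonneg fun _ _ => by positivity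
  have hGb : 0 ≤ chG θ b q v := Finset.sum_nonneg fun _ _ => by positivity
  have key : θ * chG θ b q v - θ * chG θ a p v ≤
      θ ^ 2 * h * (inner ℝ v v * ((chG θ b q v + chG θ a p v) / 2)) := by
    have e1 : inner ℝ v v * ((chG θ b q v + chG θ a p v) / 2) =
        ∑ j, ∑ i, (inner ℝ (q j) v) ^ 2 * (inner ℝ (p i) v) ^ 2 *
          ((Real.exp (θ * a i) + Real.exp (θ * b j)) / 2) := by
      have e2 : inner ℝ v v * chG θ b q v =
          ∑ j, ∑ i, (inner ℝ (q j) v) ^ 2 * (inner ℝ (p i) v) ^ 2 * Real.exp (θ * b j) := by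
        rw [← ch_parseval p v v, chG, Finset.sum_mul_sum, Finset.sum_comm]
        refine Finset.sum_congr rfl fun j _ => Finset.sum_congr rfl fun i _ => ?_
        ring
      have e3 : inner ℝ v v * chG θ a p v =
          ∑ j, ∑ i, (inner ℝ (q j) v) ^ 2 * (inner ℝ (p i) v) ^ 2 * Real.exp (θ * a i) := by
        rw [← ch_parseval q v v, chG, Finset.sum_mul_sum]
        refine Finset.sum_congr rfl fun j _ => Finset.sum_congr rfl fun i _ => ?_
        ring
      calc _ = (inner ℝ v v * chG θ b q v + inner ℝ v v * chG θ a p v) / 2 := by ring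
        _ = _ := by
          rw [e2, e3, ← Finset.sum_add_distrib, Finset.sum_div]
          refine Finset.sum_congr rfl fun j _ => ?_
          rw [← Finset.sum_add_distrib, Finset.sum_div]
          refine Finset.sum_congr rfl fun i _ => ?_
          ring
    rw [e1, ch_G_left θ b p q v, ch_G_right θ a p q v, ← mul_sub, ← Finset.sum_sub_distrib,
      Finset.mul_sum, Finset.mul_sum]
    refine Finset.sum_le_sum fun j _ => ?_
    rw [← Finset.sum_sub_distrib, Finset.mul_sum, Finset.mul_sum]
    refine Finset.sum_le_sum fun i _ => ?_
    have h1 := H j i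
    set x : ℝ := inner ℝ (q j) v
    set y : ℝ := inner ℝ (p i) v
    set w : ℝ := inner ℝ (q j) (p i)
    have h4 := ch_logmean_sq (θ * a i) (θ * b j)
    set ea := Real.exp (θ * a i)
    set eb := Real.exp (θ * b j)
    by_cases hab : b j = a i
    · have : eb = ea := by simp only [ea, eb, hab]
      have hea : 0 < ea := Real.exp_pos _
      rw [this, sub_self, mul_zero]
      positivity
    · have hne : b j - a i ≠ 0 := sub_ne_zero.2 hab
      have hw : w = h * (x * y) / (b j - a i) := by field_simp; linarith
      have hpos : 0 < (b j - a i) ^ 2 := by positivity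
      rw [← mul_le_mul_iff_of_pos_left hpos]
      have h5 := mul_le_mul_of_nonneg_left h4 (by positivity : 0 ≤ h * (x * y) ^ 2)
      calc _ = (x * y) * ((b j - a i) * w) * ((eb - ea) * (θ * b j - θ * a i)) := by ring
        _ = h * (x * y) ^ 2 * ((eb - ea) * (θ * b j - θ * a i)) := by rw [← h1]; ring
        _ ≤ _ := h5
        _ = _ := by ring
  have k2 : inner ℝ v v * ((chG θ b q v + chG θ a p v) / 2) ≤
      M * ((chG θ b q v + chG θ a p v) / 2) :=
    mul_le_mul_of_nonneg_right hM (by positivity)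
  have k3 := mul_le_mul_of_nonneg_left k2 (by positivity : 0 ≤ θ ^ 2 * h)
  nlinarith

lemma ch_G_mono (θ : ℝ) (a b : Fin d → ℝ)
    (p q : OrthonormalBasis (Fin d) ℝ (EuclideanSpace ℝ (Fin d)))
    (u v : EuclideanSpace ℝ (Fin d))
    (H : ∀ j i, inner ℝ (q j) u * inner ℝ (p i) u - inner ℝ (q j) v * inner ℝ (p i) v =
      (b j - a i) * inner ℝ (q j) (p i)) :
    0 ≤ θ * ((chG θ b q u - chG θ b q v) + (chG θ a p v - chG θ a p u)) := by
  have : θ * ((chG θ b q u - chG θ b q v) + (chG θ a p v - chG θ a p u)) =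
      ∑ j, ∑ i, inner ℝ (q j) (p i) ^ 2 *
        ((θ * b j - θ * a i) * (Real.exp (θ * b j) - Real.exp (θ * a i))) := by
    rw [ch_G_left θ b p q u, ch_G_left θ b p q v, ch_G_right θ a p q u, ch_G_right θ a p q v]
    rw [← Finset.sum_sub_distrib, ← Finset.sum_sub_distrib, ← Finset.sum_add_distrib,
      Finset.mul_sum]
    refine Finset.sum_congr rfl fun j _ => ?_
    rw [← Finset.sum_sub_distrib, ← Finset.sum_sub_distrib, ← Finset.sum_add_distrib,
      Finset.mul_sum]
    refine Finset.sum_congr rfl fun i _ => ?_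
    have h1 := H j i
    calc _ = θ * (inner ℝ (q j) u * inner ℝ (p i) u - inner ℝ (q j) v * inner ℝ (p i) v) *
          inner ℝ (q j) (p i) * (Real.exp (θ * b j) - Real.exp (θ * a i)) := by ring
      _ = _ := by rw [h1]; ring
  rw [this]
  exact Finset.sum_nonneg fun j _ => Finset.sum_nonneg fun i _ =>
    mul_nonneg (sq_nonneg _) (ch_exp_mono _ _)

end abs

/-! Matrix level -/
section mat
variable {d : ℕ}

noncomputable def chF (θ : ℝ) {A : Matrix (Fin d) (Fin d) ℝ} (hA : A.IsHermitian) : ℝ :=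
  ∑ j, Real.exp (θ * hA.eigenvalues j)

noncomputable def chGm (θ : ℝ) {A : Matrix (Fin d) (Fin d) ℝ} (hA : A.IsHermitian)
    (v : EuclideanSpace ℝ (Fin d)) : ℝ :=
  chG θ hA.eigenvalues hA.eigenvectorBasis v

lemma ch_inner (x y : EuclideanSpace ℝ (Fin d)) :
    inner ℝ x y = x.ofLp ⬝ᵥ y.ofLp := by
  rw [EuclideanSpace.inner_eq_star_dotProduct, dotProduct_comm]; simp

lemma ch_cross {A B : Matrix (Fin d) (Fin d) ℝ} (hA : A.IsHermitian) (hB : B.IsHermitian)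
    (j i : Fin d) :
    (hB.eigenvectorBasis j).ofLp ⬝ᵥ ((B - A) *ᵥ (hA.eigenvectorBasis i).ofLp) =
      (hB.eigenvalues j - hA.eigenvalues i) *
        inner ℝ (hB.eigenvectorBasis j) (hA.eigenvectorBasis i) := by
  rw [sub_mulVec, dotProduct_sub, hA.mulVec_eigenvectorBasis, dotProduct_mulVec,
    ← mulVec_transpose]
  have : Bᵀ = B := by rw [← conjTranspose_eq_transpose_of_trivial]; exact hB
  rw [this, hB.mulVec_eigenvectorBasis, ch_inner, smul_dotProduct, dotProduct_smul]
  simp only [smul_eq_mul]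
  ring

lemma ch_rank1 (x y v : EuclideanSpace ℝ (Fin d)) :
    x.ofLp ⬝ᵥ (vecMulVec v.ofLp v.ofLp *ᵥ y.ofLp) = inner ℝ x v * inner ℝ y v := by
  rw [vecMulVec_mulVec, ch_inner, ch_inner, dotProduct_comm y.ofLp]
  simp [mul_comm]

lemma ch_herm_add {Y : Matrix (Fin d) (Fin d) ℝ} (hY : Y.IsHermitian) (t : ℝ)
    (v : EuclideanSpace ℝ (Fin d)) : (Y + t • vecMulVec v.ofLp v.ofLp).IsHermitian := by
  unfold Matrix.IsHermitian at *
  rw [conjTranspose_add, hY]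
  congr 1
  ext i j
  simp [vecMulVec_apply, mul_comm]

lemma ch_onestep_N (θ M : ℝ) {Y : Matrix (Fin d) (Fin d) ℝ} (hY : Y.IsHermitian)
    (v : EuclideanSpace ℝ (Fin d)) (hM : inner ℝ v v ≤ M) (N : ℕ) (hN : 0 < N)
    (hN2 : |θ * M| < 2 * N) (k : ℕ) :
    (θ * chGm θ (ch_herm_add hY (k / N : ℝ) v) v ≤
      ((1 + θ * M / 2 / N) / (1 - θ * M / 2 / N)) ^ k * (θ * chGm θ (ch_herm_add hY 0 v) v)) ∧
    chF θ (ch_herm_add hY (k / N : ℝ) v) - chF θ (ch_herm_add hY 0 v) ≤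
      (∑ l ∈ Finset.range k, ((1 + θ * M / 2 / N) / (1 - θ * M / 2 / N)) ^ (l + 1)) *
        ((1 / N) * (θ * chGm θ (ch_herm_add hY 0 v) v)) := by
  have hNpos : (0 : ℝ) < N := by exact_mod_cast hN
  have habs := abs_lt.1 hN2
  have hx1 : 0 < 1 - θ * M / 2 / N := by
    rw [sub_pos, div_lt_one hNpos]; linarith
  have hx2 : 0 < 1 + θ * M / 2 / N := by
    have : -1 < θ * M / 2 / N := by rw [lt_div_iff₀ hNpos]; linarith
    linarith
  set ρ := (1 + θ * M / 2 / N) / (1 - θ * M / 2 / N) with hρ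
  have hρ0 : 0 < ρ := by positivity
  induction k with
  | zero => simp
  | succ k ih =>
    have H : ∀ j i, (1 / N : ℝ) *
        (inner ℝ ((ch_herm_add hY ((k + 1 : ℕ) / N : ℝ) v).eigenvectorBasis j) v *
        inner ℝ ((ch_herm_add hY (k / N : ℝ) v).eigenvectorBasis i) v) =
        ((ch_herm_add hY ((k + 1 : ℕ) / N : ℝ) v).eigenvalues j -
          (ch_herm_add hY (k / N : ℝ) v).eigenvalues i) *
        inner ℝ ((ch_herm_add hY ((k + 1 : ℕ) / N : ℝ) v).eigenvectorBasis j)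
          ((ch_herm_add hY (k / N : ℝ) v).eigenvectorBasis i) := by
      intro j i
      rw [← ch_cross, ← ch_rank1, add_sub_add_left_eq_sub, ← sub_smul, smul_mulVec,
        dotProduct_smul, smul_eq_mul]
      congr 1
      push_cast
      ring
    obtain ⟨ih1, ih2⟩ := ih
    have s1 := ch_G_step θ (1 / N) M (by positivity) _ _ _ _ v hM H
    have s2 := ch_F_step θ (1 / N) _ _ _ _ v H
    have s3 : θ * chGm θ (ch_herm_add hY ((k + 1 : ℕ) / N : ℝ) v) v ≤
        ρ * (θ * chGm θ (ch_herm_add hY (k / N : ℝ) v) v) := by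
      rw [hρ, div_mul_eq_mul_div, le_div_iff₀ hx1]
      have e : θ * (1 / N) * M / 2 = θ * M / 2 / N := by ring
      rw [e] at s1
      rw [mul_comm]
      exact s1
    have s4 : θ * chGm θ (ch_herm_add hY ((k + 1 : ℕ) / N : ℝ) v) v ≤
        ρ ^ (k + 1) * (θ * chGm θ (ch_herm_add hY 0 v) v) := by
      calc _ ≤ _ := s3
        _ ≤ ρ * _ := mul_le_mul_of_nonneg_left ih1 hρ0.le
        _ = _ := by ring
    refine ⟨s4, ?_⟩
    rw [Finset.sum_range_succ, add_mul]
    have s5 := mul_le_mul_of_nonneg_left s4 (by positivity : (0:ℝ) ≤ 1 / N)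
    have s6 : chF θ (ch_herm_add hY ((k + 1 : ℕ) / N : ℝ) v) -
        chF θ (ch_herm_add hY (k / N : ℝ) v) ≤
        1 / N * (θ * chGm θ (ch_herm_add hY ((k + 1 : ℕ) / N : ℝ) v) v) := s2
    nlinarith

end mat

section mat2
variable {d : ℕ}

lemma chF_congr (θ : ℝ) {A B : Matrix (Fin d) (Fin d) ℝ} (h : A = B) (hA : A.IsHermitian)
    (hB : B.IsHermitian) : chF θ hA = chF θ hB := by subst h; rfl

lemma chGm_congr (θ : ℝ) {A B : Matrix (Fin d) (Fin d) ℝ} (h : A = B) (hA : A.IsHermitian)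
    (hB : B.IsHermitian) (v : EuclideanSpace ℝ (Fin d)) : chGm θ hA v = chGm θ hB v := by
  subst h; rfl

lemma ch_onestep (θ M : ℝ) (hM0 : 0 < M) {Y Y' : Matrix (Fin d) (Fin d) ℝ} (hY : Y.IsHermitian)
    (hY' : Y'.IsHermitian) (v : EuclideanSpace ℝ (Fin d)) (hM : inner ℝ v v ≤ M)
    (hYY : Y' = Y + vecMulVec v.ofLp v.ofLp) :
    chF θ hY' ≤ chF θ hY + (Real.exp (θ * M) - 1) / M * chGm θ hY v := by
  have e0 : Y + (0 : ℝ) • vecMulVec v.ofLp v.ofLp = Y := by simp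
  have key : ∀ N : ℕ, 0 < N → |θ * M| < 2 * N → M * (chF θ hY' - chF θ hY) ≤
      (1 + θ * M / 2 / N) * ((1 + θ * M / 2 / N) ^ N / (1 + (-(θ * M / 2)) / N) ^ N - 1) *
        chGm θ hY v := by
    intro N hN hN2
    have hNpos : (0 : ℝ) < N := by exact_mod_cast hN
    have h := (ch_onestep_N θ M hY v hM N hN hN2 N).2
    rw [chF_congr θ (A := Y + ((N : ℝ) / N) • vecMulVec v.ofLp v.ofLp)
      (by rw [div_self hNpos.ne', one_smul, hYY]) _ hY', chF_congr θ e0 _ hY,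
      chGm_congr θ e0 _ hY] at h
    have habs := abs_lt.1 hN2
    have hx1 : 0 < 1 - θ * M / 2 / N := by
      rw [sub_pos, div_lt_one hNpos]; linarith
    have e1 : (1 + (-(θ * M / 2)) / N : ℝ) = 1 - θ * M / 2 / N := by ring
    rw [e1, ← div_pow]
    have e2 : θ * M / N = 2 * (θ * M / 2 / N) := by ring
    set y := θ * M / 2 / N
    set ρ := (1 + y) / (1 - y) with hρ
    have hg := mul_geom_sum ρ N
    have h2 : 2 * y * ρ = (1 + y) * (ρ - 1) := by
      rw [hρ]; field_simp; ring
    rw [← hg]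
    have h3 := mul_le_mul_of_nonneg_left h hM0.le
    refine h3.trans (le_of_eq ?_)
    have h4 : ∑ l ∈ Finset.range N, ρ ^ (l + 1) = ρ * ∑ l ∈ Finset.range N, ρ ^ l := by
      rw [Finset.mul_sum]; exact Finset.sum_congr rfl fun _ _ => by ring
    rw [h4]
    calc _ = (θ * M / N) * ρ * (∑ l ∈ Finset.range N, ρ ^ l) * chGm θ hY v := by ring
      _ = _ := by rw [e2, h2]; ring
  have t1 := Real.tendsto_one_add_div_pow_exp (θ * M / 2)
  have t2 := Real.tendsto_one_add_div_pow_exp (-(θ * M / 2))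
  have t3 : Filter.Tendsto (fun N : ℕ => 1 + θ * M / 2 / (N : ℝ)) Filter.atTop (nhds (1 + 0)) :=
    (tendsto_const_div_atTop_nhds_zero_nat (θ * M / 2)).const_add 1
  have t4 := (t3.mul ((t1.div t2 (Real.exp_pos _).ne').sub_const 1)).mul_const (chGm θ hY v)
  have hlim := ge_of_tendsto (b := M * (chF θ hY' - chF θ hY)) t4 (by
    obtain ⟨N0, hN0⟩ := exists_nat_gt (|θ * M|)
    filter_upwards [Filter.eventually_ge_atTop (N0 + 1)] with N hN
    have : (N0 : ℝ) + 1 ≤ N := by exact_mod_cast hN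
    exact key N (by omega) (by nlinarith [abs_nonneg (θ * M)]))
  rw [← Real.exp_sub, add_zero, one_mul, show θ * M / 2 - -(θ * M / 2) = θ * M by ring] at hlim
  have : chF θ hY' - chF θ hY ≤ (Real.exp (θ * M) - 1) * chGm θ hY v / M := by
    rw [le_div_iff₀ hM0]; linarith
  calc _ ≤ chF θ hY + (Real.exp (θ * M) - 1) * chGm θ hY v / M := by linarith
    _ = _ := by ring

end mat2

section comb
variable {m : ℕ}

lemma ch_comb1 (k : ℕ) (φ : Finset (Fin m) → ℝ) :
    ((k : ℝ) + 1) * ∑ A ∈ Finset.powersetCard (k + 1) Finset.univ, φ A =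
    ∑ A ∈ Finset.powersetCard k Finset.univ, ∑ i ∈ Aᶜ, φ (insert i A) := by
  have h1 : ((k : ℝ) + 1) * ∑ A ∈ Finset.powersetCard (k + 1) Finset.univ, φ A =
      ∑ A ∈ Finset.powersetCard (k + 1) (Finset.univ : Finset (Fin m)), ∑ i ∈ A, φ A := by
    rw [Finset.mul_sum]
    refine Finset.sum_congr rfl fun A hA => ?_
    rw [Finset.sum_const, (Finset.mem_powersetCard.1 hA).2, nsmul_eq_mul]
    push_cast; ring
  rw [h1, Finset.sum_sigma', Finset.sum_sigma']
  refine Finset.sum_bij' (fun x _ => ⟨x.1.erase x.2, x.2⟩) (fun x _ => ⟨insert x.2 x.1, x.2⟩)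
    ?_ ?_ ?_ ?_ ?_
  · rintro ⟨A, i⟩ h
    simp [Finset.mem_powersetCard] at h ⊢
    rw [Finset.card_erase_of_mem h.2]; omega
  · rintro ⟨A, i⟩ h
    simp [Finset.mem_powersetCard] at h ⊢
    rw [Finset.card_insert_of_notMem h.2]; omega
  · rintro ⟨A, i⟩ h
    simp at h
    simp [Finset.insert_erase h.2]
  · rintro ⟨A, i⟩ h
    simp at h
    simp [Finset.erase_insert h.2]
  · rintro ⟨A, i⟩ h
    simp at h
    simp [Finset.insert_erase h.2]

lemma ch_comb2 (k : ℕ) (ψ : Finset (Fin m) → Fin m → Fin m → ℝ) :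
    ∑ A ∈ Finset.powersetCard k (Finset.univ : Finset (Fin m)), ∑ i ∈ A, ∑ j ∈ Aᶜ, ψ A i j =
    ∑ A ∈ Finset.powersetCard k (Finset.univ : Finset (Fin m)), ∑ i ∈ A, ∑ j ∈ Aᶜ,
      ψ (insert j (A.erase i)) j i := by
  have hs : ∀ χ : Finset (Fin m) → Fin m → Fin m → ℝ,
      ∑ A ∈ Finset.powersetCard k (Finset.univ : Finset (Fin m)), ∑ i ∈ A, ∑ j ∈ Aᶜ, χ A i j =
      ∑ x ∈ (Finset.powersetCard k (Finset.univ : Finset (Fin m))).sigma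
        (fun A => A ×ˢ Aᶜ), χ x.1 x.2.1 x.2.2 := by
    intro χ
    rw [Finset.sum_sigma]
    refine Finset.sum_congr rfl fun A _ => ?_
    rw [Finset.sum_product]
  rw [hs, hs (fun A i j => ψ (insert j (A.erase i)) j i)]
  refine Finset.sum_bij' (fun x _ => ⟨insert x.2.2 (x.1.erase x.2.1), (x.2.2, x.2.1)⟩)
    (fun x _ => ⟨insert x.2.2 (x.1.erase x.2.1), (x.2.2, x.2.1)⟩) ?_ ?_ ?_ ?_ ?_
  · rintro ⟨A, i, j⟩ h
    simp [Finset.mem_powersetCard] at h ⊢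
    refine ⟨?_, fun h3 => h.2.2 (h3 ▸ h.2.1)⟩
    rw [Finset.card_insert_of_notMem (by simp [h.2.2]), Finset.card_erase_of_mem h.2.1]
    have := Finset.card_pos.2 ⟨i, h.2.1⟩
    omega
  · rintro ⟨A, i, j⟩ h
    simp [Finset.mem_powersetCard] at h ⊢
    refine ⟨?_, fun h3 => h.2.2 (h3 ▸ h.2.1)⟩
    rw [Finset.card_insert_of_notMem (by simp [h.2.2]), Finset.card_erase_of_mem h.2.1]
    have := Finset.card_pos.2 ⟨i, h.2.1⟩
    omega
  · rintro ⟨A, i, j⟩ h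
    simp at h
    simp [h.2.2, Finset.insert_erase h.2.1]
  · rintro ⟨A, i, j⟩ h
    simp at h
    simp [h.2.2, Finset.insert_erase h.2.1]
  · rintro ⟨A, i, j⟩ h
    simp at h
    simp [h.2.2, Finset.insert_erase h.2.1]

lemma ch_comb (c D : ℝ) (f : Finset (Fin m) → ℝ) (g : Finset (Fin m) → Fin m → ℝ)
    (h0 : ∀ A, 0 ≤ f A) (hD : f ∅ ≤ D)
    (h1 : ∀ A, ∀ i ∉ A, f (insert i A) ≤ f A + c * g A i)
    (h2 : ∀ A, ∑ i, g A i = f A)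
    (h3 : ∀ A, ∀ i ∈ A, ∀ j ∉ A, 0 ≤ c * ((g A i - g A j) +
      (g (insert j (A.erase i)) j - g (insert j (A.erase i)) i)))
    (k : ℕ) (hk : k ≤ m) :
    ∑ A ∈ Finset.powersetCard k Finset.univ, f A ≤
      (m.choose k : ℝ) * (D * Real.exp (c * k / m)) := by
  induction k with
  | zero => simpa using hD
  | succ k ih =>
    have ih := ih (by omega)
    have hm : (0 : ℝ) < m := by exact_mod_cast (by omega : 0 < m)
    have hkm : (k : ℝ) + 1 ≤ m := by exact_mod_cast hk
    set T := ∑ A ∈ Finset.powersetCard k (Finset.univ : Finset (Fin m)), f A with hT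
    set In := ∑ A ∈ Finset.powersetCard k (Finset.univ : Finset (Fin m)), ∑ i ∈ A, g A i with hIn
    set Out := ∑ A ∈ Finset.powersetCard k (Finset.univ : Finset (Fin m)), ∑ i ∈ Aᶜ, g A i
      with hOut
    have hT0 : 0 ≤ T := Finset.sum_nonneg fun A _ => h0 A
    have hsum : In + Out = T := by
      rw [hIn, hOut, hT, ← Finset.sum_add_distrib]
      refine Finset.sum_congr rfl fun A _ => ?_
      rw [Finset.sum_add_sum_compl, h2]
    have hcc : ∀ A ∈ Finset.powersetCard k (Finset.univ : Finset (Fin m)),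
        ((Aᶜ.card : ℕ) : ℝ) = m - k := by
      intro A hA
      rw [Finset.card_compl, (Finset.mem_powersetCard.1 hA).2, Fintype.card_fin,
        Nat.cast_sub (by omega)]
    have hdiff : ∑ A ∈ Finset.powersetCard k (Finset.univ : Finset (Fin m)),
        ∑ i ∈ A, ∑ j ∈ Aᶜ, (g A i - g A j) = (m - k) * In - k * Out := by
      rw [hIn, hOut, Finset.mul_sum, Finset.mul_sum, ← Finset.sum_sub_distrib]
      refine Finset.sum_congr rfl fun A hA => ?_
      simp only [Finset.sum_sub_distrib, Finset.sum_const, nsmul_eq_mul, hcc A hA,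
        (Finset.mem_powersetCard.1 hA).2, Finset.mul_sum]
    have hswap : 0 ≤ c * ((m - k) * In - k * Out) := by
      have e : 2 * (c * ((m - k) * In - k * Out)) =
          ∑ A ∈ Finset.powersetCard k (Finset.univ : Finset (Fin m)),
          ∑ i ∈ A, ∑ j ∈ Aᶜ, c * ((g A i - g A j) +
            (g (insert j (A.erase i)) j - g (insert j (A.erase i)) i)) := by
        simp only [← Finset.mul_sum, Finset.sum_add_distrib]
        rw [hdiff, ← ch_comb2 k (fun A i j => g A i - g A j), hdiff]
        ring
      have : 0 ≤ 2 * (c * ((m - k) * In - k * Out)) := by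
        rw [e]
        refine Finset.sum_nonneg fun A _ => Finset.sum_nonneg fun i hi =>
          Finset.sum_nonneg fun j hj => h3 A i hi j (Finset.mem_compl.1 hj)
      linarith
    have hstep : ((k : ℝ) + 1) * ∑ A ∈ Finset.powersetCard (k + 1) Finset.univ, f A ≤
        (m - k) * T + c * Out := by
      rw [ch_comb1, hT, hOut, Finset.mul_sum, Finset.mul_sum, ← Finset.sum_add_distrib]
      refine Finset.sum_le_sum fun A hA => ?_
      calc _ ≤ ∑ i ∈ Aᶜ, (f A + c * g A i) :=
            Finset.sum_le_sum fun i hi => h1 A i (Finset.mem_compl.1 hi)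
        _ = _ := by
          rw [Finset.sum_add_distrib, Finset.sum_const, nsmul_eq_mul, hcc A hA, Finset.mul_sum]
    have hOutb : c * Out ≤ (m - k) * (c / m * T) := by
      have : m * (c * Out) ≤ (m - k) * (c * T) := by rw [← hsum]; nlinarith
      have e : (m - k) * (c / m * T) = (m - k) * (c * T) / m := by ring
      rw [e, le_div_iff₀ hm]; linarith
    have hexp := Real.add_one_le_exp (c / m)
    have hch : ((k : ℝ) + 1) * (m.choose (k + 1) : ℝ) = (m - k) * m.choose k := by
      have := Nat.choose_succ_right_eq m k
      have h2 : ((m - k : ℕ) : ℝ) = (m : ℝ) - k := Nat.cast_sub (by omega)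
      rw [← h2]
      have h3 : ((m.choose (k + 1) * (k + 1) : ℕ) : ℝ) = ((m.choose k * (m - k) : ℕ) : ℝ) := by
        rw [this]
      push_cast at h3
      linarith
    have hkpos : (0 : ℝ) < (k : ℝ) + 1 := by positivity
    rw [← mul_le_mul_iff_of_pos_left hkpos, ← mul_assoc, hch]
    have hmk : (0 : ℝ) ≤ m - k := by linarith
    calc _ ≤ (m - k) * T + c * Out := hstep
      _ ≤ (m - k) * ((c / m + 1) * T) := by linarith
      _ ≤ (m - k) * (Real.exp (c / m) * T) := by gcongr
      _ ≤ (m - k) * (Real.exp (c / m) * ((m.choose k : ℝ) * (D * Real.exp (c * k / m)))) := by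
        gcongr
      _ = _ := by
        have : Real.exp (c * ((k + 1 : ℕ) : ℝ) / m) = Real.exp (c / m) * Real.exp (c * k / m) := by
          rw [← Real.exp_add]; congr 1; push_cast; ring
        rw [this]; ring

end comb

section final
variable {m d : ℕ}

noncomputable def chRow (V : Matrix (Fin m) (Fin d) ℝ) (i : Fin m) : EuclideanSpace ℝ (Fin d) :=
  WithLp.toLp 2 (V i)

noncomputable def chS (V : Matrix (Fin m) (Fin d) ℝ) (A : Finset (Fin m)) :
    Matrix (Fin d) (Fin d) ℝ :=
  ∑ i ∈ A, vecMulVec (chRow V i).ofLp (chRow V i).ofLp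

lemma chS_eq (V : Matrix (Fin m) (Fin d) ℝ) (A : Finset (Fin m)) :
    (Vᵀ * samplingOf A) * (Vᵀ * samplingOf A)ᴴ = chS V A := by
  ext a b
  simp [chS, chRow, mul_apply, samplingOf, vecMulVec_apply, Matrix.sum_apply]
  exact Finset.sum_attach A (fun i => V i a * V i b)

lemma chS_herm (V : Matrix (Fin m) (Fin d) ℝ) (A : Finset (Fin m)) : (chS V A).IsHermitian := by
  rw [← chS_eq]; exact Matrix.isHermitian_mul_conjTranspose_self _

lemma ch_gramEigs (V : Matrix (Fin m) (Fin d) ℝ) (A : Finset (Fin m)) :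
    gramEigs (Vᵀ * samplingOf A) = (chS_herm V A).eigenvalues := by
  have : ∀ {X Y : Matrix (Fin d) (Fin d) ℝ} (_ : X = Y) (hX : X.IsHermitian)
      (hY : Y.IsHermitian), hX.eigenvalues = hY.eigenvalues := by
    intro X Y h hX hY; subst h; rfl
  exact this (chS_eq V A) _ _

lemma ch_row_inner (V : Matrix (Fin m) (Fin d) ℝ) (i : Fin m) :
    inner ℝ (chRow V i) (chRow V i) = ∑ j, V i j ^ 2 := by
  rw [ch_inner]; simp [chRow, dotProduct, sq]

lemma ch_row_le (V : Matrix (Fin m) (Fin d) ℝ) (i : Fin m) :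
    inner ℝ (chRow V i) (chRow V i) ≤ coherence V := by
  rw [ch_row_inner]
  exact le_ciSup (f := fun i : Fin m => ∑ j, V i j ^ 2) (Set.finite_range _).bddAbove i

lemma ch_sum_rows (V : Matrix (Fin m) (Fin d) ℝ) (hV : Vᵀ * V = 1)
    (x : EuclideanSpace ℝ (Fin d)) :
    ∑ i, (inner ℝ x (chRow V i)) ^ 2 = inner ℝ x x := by
  have h1 : ∀ i, inner ℝ x (chRow V i) = (V *ᵥ x.ofLp) i := by
    intro i; rw [ch_inner, dotProduct_comm]; rfl
  have h2 : ∑ i, (inner ℝ x (chRow V i)) ^ 2 = (V *ᵥ x.ofLp) ⬝ᵥ (V *ᵥ x.ofLp) := by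
    simp only [h1, dotProduct, sq]
  rw [h2, dotProduct_mulVec, ← mulVec_transpose, mulVec_mulVec, hV, one_mulVec, ch_inner]

lemma ch_sum_G (θ : ℝ) (V : Matrix (Fin m) (Fin d) ℝ) (hV : Vᵀ * V = 1)
    {A : Matrix (Fin d) (Fin d) ℝ} (hA : A.IsHermitian) :
    ∑ i, chGm θ hA (chRow V i) = chF θ hA := by
  unfold chGm chG chF
  rw [Finset.sum_comm]
  refine Finset.sum_congr rfl fun j _ => ?_
  rw [← Finset.sum_mul, ch_sum_rows V hV, real_inner_self_eq_norm_sq,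
    (hA.eigenvectorBasis).norm_eq_one]
  simp

lemma ch_coh_pos (V : Matrix (Fin m) (Fin d) ℝ) (hV : Vᵀ * V = 1) (hd : 0 < d) :
    0 < coherence V := by
  by_contra hc
  push Not at hc
  have h0 : ∀ i, chRow V i = 0 := by
    intro i
    have := (ch_row_le V i).trans hc
    exact inner_self_eq_zero.1 (le_antisymm this real_inner_self_nonneg)
  have h1 := ch_sum_rows V hV (EuclideanSpace.single ⟨0, hd⟩ 1)
  simp [h0] at h1

lemma ch_empty (θ : ℝ) (V : Matrix (Fin m) (Fin d) ℝ) : chF θ (chS_herm V ∅) = d := by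
  have h : ∀ j, (chS_herm V ∅).eigenvalues j = 0 := by
    have : (chS_herm V ∅).eigenvalues = 0 := by
      rw [Matrix.IsHermitian.eigenvalues_eq_zero_iff]; simp [chS]
    intro j; rw [this]; rfl
  simp [chF, h]

lemma ch_mgf (θ : ℝ) (V : Matrix (Fin m) (Fin d) ℝ) (hV : Vᵀ * V = 1) (M : ℝ) (hM0 : 0 < M)
    (hM : ∀ i, inner ℝ (chRow V i) (chRow V i) ≤ M) (k : ℕ) (hk : k ≤ m) :
    ∑ A ∈ Finset.powersetCard k Finset.univ, chF θ (chS_herm V A) ≤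
      (m.choose k : ℝ) * (d * Real.exp ((Real.exp (θ * M) - 1) / M * k / m)) := by
  refine ch_comb _ d (fun A => chF θ (chS_herm V A))
    (fun A i => chGm θ (chS_herm V A) (chRow V i)) ?_ ?_ ?_ ?_ ?_ k hk
  · intro A; exact Finset.sum_nonneg fun _ _ => (Real.exp_pos _).le
  · exact (ch_empty θ V).le
  · intro A i hi
    refine ch_onestep θ M hM0 _ _ _ (hM i) ?_
    rw [chS, Finset.sum_insert hi, add_comm]; rfl
  · intro A; exact ch_sum_G θ V hV _
  · intro A i hi j hj
    have key := ch_G_mono θ (chS_herm V (insert j (A.erase i))).eigenvalues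
      (chS_herm V A).eigenvalues (chS_herm V (insert j (A.erase i))).eigenvectorBasis
      (chS_herm V A).eigenvectorBasis (chRow V i) (chRow V j) (by
        intro b a
        rw [← ch_cross, ← ch_rank1, ← ch_rank1, ← dotProduct_sub, ← sub_mulVec]
        congr 2
        unfold chS
        rw [Finset.sum_insert (by simp [hj]), ← Finset.add_sum_erase A _ hi]
        abel)
    have key2 : 0 ≤ θ * ((chGm θ (chS_herm V A) (chRow V i) - chGm θ (chS_herm V A) (chRow V j)) +
        (chGm θ (chS_herm V (insert j (A.erase i))) (chRow V j) -
        chGm θ (chS_herm V (insert j (A.erase i))) (chRow V i))) := key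
    generalize ((chGm θ (chS_herm V A) (chRow V i) - chGm θ (chS_herm V A) (chRow V j)) +
        (chGm θ (chS_herm V (insert j (A.erase i))) (chRow V j) -
        chGm θ (chS_herm V (insert j (A.erase i))) (chRow V i))) = X at key2 ⊢
    rw [div_mul_eq_mul_div]
    refine div_nonneg ?_ hM0.le
    rcases lt_trichotomy θ 0 with h | h | h
    · have hX : X ≤ 0 := by nlinarith
      have : Real.exp (θ * M) ≤ 1 := Real.exp_le_one_iff.2 (by nlinarith)
      nlinarith
    · simp [h]
    · have hX : 0 ≤ X := by nlinarith
      have : 1 ≤ Real.exp (θ * M) := Real.one_le_exp (by positivity)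
      nlinarith

lemma ch_tail {s : ℕ} (hs : 0 < s) (hsm : s ≤ m) (V : Matrix (Fin m) (Fin d) ℝ) (hV : Vᵀ * V = 1)
    (α x : ℝ) (hx : 0 < x)
    (hsmp : α * ((m : ℝ) * coherence V) * Real.log d ≤ (s : ℝ))
    (B : Finset (Finset (Fin m))) (hB : B ⊆ Finset.powersetCard s Finset.univ)
    (hBe : ∀ A ∈ B, ∃ i, Real.log x * (x * s / m) ≤
      Real.log x * gramEigs (Vᵀ * samplingOf A) i) :
    (B.card : ℝ) ≤ (m.choose s : ℝ) *
      (d * (Real.exp (x - 1) / x ^ x) ^ (α * Real.log d)) := by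
  rcases Nat.eq_zero_or_pos d with hd | hd
  · subst hd
    have : B = ∅ := by
      rw [Finset.eq_empty_iff_forall_notMem]
      intro A hA
      obtain ⟨i, -⟩ := hBe A hA
      exact i.elim0
    simp [this]
  set M := coherence V with hMdef
  have hM0 : 0 < M := ch_coh_pos V hV hd
  have hm : (0 : ℝ) < m := by exact_mod_cast (by omega : 0 < m)
  set θ := Real.log x / M with hθ
  have h1 := ch_mgf θ V hV M hM0 (ch_row_le V) s hsm
  have h2 : (B.card : ℝ) * Real.exp (θ * (x * s / m)) ≤
      ∑ A ∈ Finset.powersetCard s Finset.univ, chF θ (chS_herm V A) := by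
    calc _ = ∑ A ∈ B, Real.exp (θ * (x * s / m)) := by simp
      _ ≤ ∑ A ∈ B, chF θ (chS_herm V A) := by
        refine Finset.sum_le_sum fun A hA => ?_
        obtain ⟨i, hi⟩ := hBe A hA
        rw [ch_gramEigs] at hi
        refine le_trans ?_ (Finset.single_le_sum
          (f := fun j => Real.exp (θ * (chS_herm V A).eigenvalues j))
          (fun _ _ => (Real.exp_pos _).le) (Finset.mem_univ i))
        apply Real.exp_le_exp.2
        rw [hθ, div_mul_eq_mul_div, div_mul_eq_mul_div]
        gcongr
      _ ≤ _ := Finset.sum_le_sum_of_subset_of_nonneg hB fun _ _ _ =>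
        Finset.sum_nonneg fun _ _ => (Real.exp_pos _).le
  have h3 := h2.trans h1
  have e1 : Real.exp (θ * M) = x := by
    rw [hθ, div_mul_cancel₀ _ hM0.ne', Real.exp_log hx]
  rw [e1] at h3
  have hbase : Real.exp (x - 1) / x ^ x = Real.exp (x - 1 - x * Real.log x) := by
    rw [Real.rpow_def_of_pos hx, ← Real.exp_sub, mul_comm]
  rw [hbase, ← Real.exp_mul]
  have hneg : x - 1 - x * Real.log x ≤ 0 := by
    have := Real.one_sub_inv_le_log_of_pos hx
    have h := mul_le_mul_of_nonneg_left this hx.le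
    rw [mul_sub, mul_inv_cancel₀ hx.ne'] at h
    linarith
  have hexp : (x - 1) / M * s / m - θ * (x * s / m) ≤
      (x - 1 - x * Real.log x) * (α * Real.log d) := by
    have e : (x - 1) / M * s / m - θ * (x * s / m) =
        (x - 1 - x * Real.log x) * (s / (m * M)) := by
      rw [hθ]; field_simp
    rw [e]
    apply mul_le_mul_of_nonpos_left _ hneg
    rw [le_div_iff₀ (by positivity)]
    linarith
  have h4 : (B.card : ℝ) ≤ (m.choose s : ℝ) *
      (d * Real.exp ((x - 1) / M * s / m - θ * (x * s / m))) := by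
    rw [Real.exp_sub, mul_div_assoc', mul_div_assoc', le_div_iff₀ (Real.exp_pos _)]
    exact h3
  refine h4.trans ?_
  gcongr

end final

/-- Let `r ≤ n ≤ m` be positive integers, let `V₁ ∈ ℝ^{m×r}` and
`V₂ ∈ ℝ^{m×(n−r)}` have orthonormal columns, and set `M₁ = m·μ(V₁)`, `M₂ = m·μ(V₂)`.
Sample `s` column indices uniformly at random without replacement from `{1,…,m}` and let
`E` be the sampling matrix with the corresponding canonical basis vectors as columns.
If `s ≥ max{α₁ M₁ log r, α₂ M₂ log(n−r)}` with `α₁, α₂ ≥ 0`, then for every `δ ∈ [0,1)`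
and `η ∈ [0, m/s − 1]`, the probability (ratio of favorable subsets among all `s`-element
subsets) that `σ_r(V₁ᵀE) < √((1−δ)s/m)` or `σ₁(V₂ᵀE) > √((1+η)s/m)` — equivalently, that
some eigenvalue of `(V₁ᵀE)(V₁ᵀE)ᵀ` is `< (1−δ)s/m` or some eigenvalue of `(V₂ᵀE)(V₂ᵀE)ᵀ`
is `> (1+η)s/m` — is at most
`r·(e^{−δ}/(1−δ)^{1−δ})^{α₁ log r} + (n−r)·(e^{η}/(1+η)^{1+η})^{α₂ log(n−r)}`. -/
theorem stmt0 {m n r s : ℕ} (hr : 0 < r) (hrn : r ≤ n) (hnm : n ≤ m) (hs : 0 < s)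
    (hsm : s ≤ m)
    (V₁ : Matrix (Fin m) (Fin r) ℝ) (V₂ : Matrix (Fin m) (Fin (n - r)) ℝ)
    (hV₁ : V₁ᵀ * V₁ = 1) (hV₂ : V₂ᵀ * V₂ = 1)
    (α₁ α₂ δ η : ℝ) (hα₁ : 0 ≤ α₁) (hα₂ : 0 ≤ α₂)
    (hsmp : max (α₁ * ((m : ℝ) * coherence V₁) * Real.log r)
        (α₂ * ((m : ℝ) * coherence V₂) * Real.log ((n : ℝ) - r)) ≤ (s : ℝ))
    (hδ0 : 0 ≤ δ) (hδ1 : δ < 1) (hη0 : 0 ≤ η) (hη1 : η ≤ (m : ℝ) / s - 1) :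
    (Nat.card {A : Finset (Fin m) // A.card = s ∧
        ((∃ i, gramEigs (V₁ᵀ * samplingOf A) i < (1 - δ) * s / m) ∨
         (∃ i, (1 + η) * s / m < gramEigs (V₂ᵀ * samplingOf A) i))} : ℝ) /
      (Nat.card {A : Finset (Fin m) // A.card = s} : ℝ) ≤
    (r : ℝ) * (Real.exp (-δ) / (1 - δ) ^ (1 - δ)) ^ (α₁ * Real.log r) +
      ((n : ℝ) - r) * (Real.exp η / (1 + η) ^ (1 + η)) ^ (α₂ * Real.log ((n : ℝ) - r)) := by
  classical
  have hc : Nat.card {A : Finset (Fin m) // A.card = s} = m.choose s := by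
    rw [Nat.card_eq_fintype_card, Fintype.card_finset_len, Fintype.card_fin]
  have hpos : (0 : ℝ) < (m.choose s : ℝ) := by exact_mod_cast Nat.choose_pos hsm
  rw [hc, div_le_iff₀ hpos]
  have hcast : ((n - r : ℕ) : ℝ) = (n : ℝ) - r := Nat.cast_sub hrn
  set B₁ := (Finset.powersetCard s (Finset.univ : Finset (Fin m))).filter
    (fun A => ∃ i, gramEigs (V₁ᵀ * samplingOf A) i < (1 - δ) * s / m) with hB₁
  set B₂ := (Finset.powersetCard s (Finset.univ : Finset (Fin m))).filter
    (fun A => ∃ i, (1 + η) * s / m < gramEigs (V₂ᵀ * samplingOf A) i) with hB₂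
  have t1 := ch_tail hs hsm V₁ hV₁ α₁ (1 - δ) (by linarith) ((le_max_left _ _).trans hsmp) B₁
    (Finset.filter_subset _ _) (by
      intro A hA
      obtain ⟨i, hi⟩ := (Finset.mem_filter.1 hA).2
      exact ⟨i, mul_le_mul_of_nonpos_left hi.le
        (Real.log_nonpos (by linarith) (by linarith))⟩)
  have t2 := ch_tail hs hsm V₂ hV₂ α₂ (1 + η) (by linarith)
    (by rw [hcast]; exact (le_max_right _ _).trans hsmp) B₂
    (Finset.filter_subset _ _) (by
      intro A hA
      obtain ⟨i, hi⟩ := (Finset.mem_filter.1 hA).2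
      exact ⟨i, mul_le_mul_of_nonneg_left hi.le (Real.log_nonneg (by linarith))⟩)
  rw [show (1 - δ - 1 : ℝ) = -δ by ring] at t1
  rw [show (1 + η - 1 : ℝ) = η by ring, hcast] at t2
  have hcard : Nat.card {A : Finset (Fin m) // A.card = s ∧
        ((∃ i, gramEigs (V₁ᵀ * samplingOf A) i < (1 - δ) * s / m) ∨
         (∃ i, (1 + η) * s / m < gramEigs (V₂ᵀ * samplingOf A) i))} ≤ B₁.card + B₂.card := by
    refine le_trans (le_of_eq ?_) (Finset.card_union_le B₁ B₂)
    rw [Nat.card_eq_fintype_card]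
    refine Fintype.card_of_subtype (B₁ ∪ B₂) fun A => ?_
    simp only [hB₁, hB₂, Finset.mem_union, Finset.mem_filter, Finset.mem_powersetCard,
      Finset.subset_univ, true_and, and_or_left]
  have hcard' : (Nat.card {A : Finset (Fin m) // A.card = s ∧
        ((∃ i, gramEigs (V₁ᵀ * samplingOf A) i < (1 - δ) * s / m) ∨
         (∃ i, (1 + η) * s / m < gramEigs (V₂ᵀ * samplingOf A) i))} : ℝ) ≤
      B₁.card + B₂.card := by exact_mod_cast hcard
  linarith
end

section
/- Let r ≤ s and r ≤ k be positive integers, let M ∈ ℝ^{r×s} be a fixed matrix of full rank r, and let Ω be a standard Gaussian s×k random matrix. Then the product MΩ ∈ ℝ^{r×k} has full rank r almost surely: the set of Ω ∈ ℝ^{s×k} with rank(MΩ) < r has measure zero under the standard Gaussian matrix measure. -/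
open MeasureTheory ProbabilityTheory Matrix

/-- The standard Gaussian measure on `a × b` real matrices (viewed as `Fin a → Fin b → ℝ`):
the product measure in which every entry is an independent standard normal. -/
noncomputable def stdGaussianMeasure (a b : ℕ) : Measure (Fin a → Fin b → ℝ) :=
  Measure.pi fun _ : Fin a => Measure.pi fun _ : Fin b => gaussianReal 0 1

theorem pi_const_ac {α : Type*} [MeasurableSpace α] (μ ν : Measure α) [SigmaFinite μ]
    [SigmaFinite ν] (h : μ ≪ ν) (n : ℕ) :
    Measure.pi (fun _ : Fin n => μ) ≪ Measure.pi (fun _ : Fin n => ν) := by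
  induction n with
  | zero => rw [Measure.pi_of_empty, Measure.pi_of_empty]
  | succ n ih =>
    have h1 := (measurePreserving_piFinSuccAbove (fun _ : Fin (n + 1) => μ) 0).symm
    have h2 := (measurePreserving_piFinSuccAbove (fun _ : Fin (n + 1) => ν) 0).symm
    rw [← h1.map_eq, ← h2.map_eq]
    exact (h.prod ih).map (MeasurableEquiv.measurable _)

theorem finite_det_zero {r : ℕ} (A : Matrix (Fin r) (Fin r) ℝ) :
    {t : ℝ | (A + t • (1 : Matrix (Fin r) (Fin r) ℝ)).det = 0}.Finite := by
  refine ((-A).charpoly.roots.toFinset.finite_toSet).subset ?_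
  intro t ht
  have h0 : (-A).charpoly ≠ 0 := (Matrix.charpoly_monic _).ne_zero
  simp only [Multiset.mem_toFinset, Finset.mem_coe, Polynomial.mem_roots h0, Polynomial.IsRoot]
  rw [Matrix.eval_charpoly, sub_neg_eq_add, add_comm, Matrix.scalar_apply, ← Matrix.smul_one_eq_diagonal]
  exact ht

theorem stmt4 {r s k : ℕ} (hr : 0 < r) (hs : 0 < s) (hk : 0 < k) (hrs : r ≤ s) (hrk : r ≤ k)
    (M : Matrix (Fin r) (Fin s) ℝ) (hM : M.rank = r) :
    stdGaussianMeasure s k {g | (M * Matrix.of g).rank < r} = 0 := by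
  have hac : stdGaussianMeasure s k ≪ (volume : Measure (Fin s → Fin k → ℝ)) :=
    pi_const_ac _ _ (pi_const_ac _ _ (gaussianReal_absolutelyContinuous 0 one_ne_zero) k) s
  apply hac
  obtain ⟨N, hN⟩ : ∃ N : Matrix (Fin s) (Fin r) ℝ, M * N = 1 := by
    rw [← Matrix.mulVec_surjective_iff_exists_right_inverse]
    have : LinearMap.range M.mulVecLin = ⊤ := by
      apply Submodule.eq_top_of_finrank_eq
      rw [← Matrix.rank, hM]; simp
    exact LinearMap.range_eq_top.1 this
  let e : Fin r → Fin k := Fin.castLE hrk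
  let P : Matrix (Fin r) (Fin k) ℝ := Matrix.of fun i j => if e i = j then 1 else 0
  have hP : (M * (N * P)).submatrix id e = 1 := by
    rw [← Matrix.mul_assoc, hN, Matrix.one_mul]
    ext i j
    simp [P, e, Matrix.one_apply]
  let f : (Fin s → Fin k → ℝ) → ℝ := fun g => ((M * Matrix.of g).submatrix id e).det
  have hf : Continuous f := by
    apply Continuous.matrix_det
    apply Continuous.matrix_submatrix
    exact continuous_const.matrix_mul continuous_id
  have hms : MeasurableSet {g | f g ≠ 0} := (isOpen_ne_fun hf continuous_const).measurableSet
  have key : ∀ᵐ g ∂(volume : Measure (Fin s → Fin k → ℝ)), g ∈ {g | f g ≠ 0} := by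
    let L : ℝ →ₗ[ℝ] (Fin s → Fin k → ℝ) := LinearMap.toSpanSingleton ℝ _ (fun i j => (N * P) i j)
    rw [← ae_ae_add_linearMap_mem_iff L (volume : Measure ℝ) volume hms]
    refine Filter.Eventually.of_forall fun y => ?_
    rw [ae_iff]
    refine Set.Finite.measure_zero ((finite_det_zero ((M * Matrix.of y).submatrix id e)).subset ?_) _
    intro t ht
    have h1 : f (y + L t) = 0 := by simpa using ht
    have h2 : M * Matrix.of (y + L t) = M * Matrix.of y + t • (M * (N * P)) := by
      rw [← Matrix.mul_smul, ← Matrix.mul_add]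
      rfl
    simp only [f, h2] at h1
    rw [← hP]
    exact h1
  rw [ae_iff] at key
  refine measure_mono_null ?_ key
  intro g hg hne
  have hu : IsUnit ((M * Matrix.of g).submatrix id e) :=
    (Matrix.isUnit_iff_isUnit_det _).2 (isUnit_iff_ne_zero.2 hne)
  have h1 := Matrix.rank_of_isUnit _ hu
  have h2 := Matrix.rank_submatrix_le (M * Matrix.of g) id e
  rw [h1, Fintype.card_fin] at h2
  exact absurd hg (not_lt.2 h2)
end

section
/- Fix real matrices S ∈ ℝ^{q×m} and T ∈ ℝ^{n×t}, and let G be a standard Gaussian m×n random matrix. Then (𝔼[‖S G T‖_F⁴])^{1/4} ≤ 3^{1/4} · ‖S‖_F · ‖T‖_F; equivalently, 𝔼[‖S G T‖_F⁴] ≤ 3 ‖S‖_F⁴ ‖T‖_F⁴. -/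
open MeasureTheory ProbabilityTheory Matrix

/-- The Frobenius norm of a real matrix. -/
noncomputable def frobNorm {ι κ : Type*} [Fintype ι] [Fintype κ] (A : Matrix ι κ ℝ) : ℝ :=
  Real.sqrt (∑ i, ∑ j, A i j ^ 2)

lemma law_sum {ι : Type*} [Fintype ι] {Ω : ι → Type*} [∀ i, MeasurableSpace (Ω i)]
    (ν : ∀ i, Measure (Ω i)) [∀ i, IsProbabilityMeasure (ν i)] (f : ∀ i, Ω i → ℝ)
    (hf : ∀ i, Measurable (f i)) (v : ι → NNReal)
    (h : ∀ i, (ν i).map (f i) = gaussianReal 0 (v i)) :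
    (Measure.pi ν).map (fun ω => ∑ i, f i (ω i)) = gaussianReal 0 (∑ i, v i) := by
  have hm : ∀ i, Measurable (fun ω : ∀ i, Ω i => f i (ω i)) :=
    fun i => (hf i).comp (measurable_pi_apply i)
  have hind : iIndepFun (fun i (ω : ∀ i, Ω i) => f i (ω i)) (Measure.pi ν) :=
    iIndepFun_pi fun i => (hf i).aemeasurable
  have : IsProbabilityMeasure ((Measure.pi ν).map (fun ω => ∑ i, f i (ω i))) :=
    Measure.isProbabilityMeasure_map (Finset.measurable_sum _ fun i _ => hm i).aemeasurable
  apply Measure.ext_of_charFun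
  rw [hind.charFun_map_fun_sum_eq_prod (fun i => (hm i).aemeasurable)]
  ext t
  have h2 : ∀ i, (Measure.pi ν).map (fun ω => f i (ω i)) = gaussianReal 0 (v i) := by
    intro i
    rw [← h i, ← (measurePreserving_eval ν i).map_eq,
      Measure.map_map (hf i) (measurable_pi_apply i)]
    rfl
  simp only [h2, Finset.prod_apply, charFun_gaussianReal, ← Complex.exp_sum]
  congr 1
  simp [Finset.sum_div, Finset.sum_mul]

lemma law_lin {n : ℕ} {Ω : Type*} [MeasurableSpace Ω] (ν : Measure Ω) [IsProbabilityMeasure ν]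
    (f : Ω → ℝ) (hf : Measurable f) (v : NNReal) (h : ν.map f = gaussianReal 0 v)
    (c : Fin n → ℝ) :
    (Measure.pi (fun _ : Fin n => ν)).map (fun ω => ∑ i, c i * f (ω i)) =
      gaussianReal 0 (∑ i, NNReal.mk (c i ^ 2) (sq_nonneg _) * v) := by
  refine law_sum (fun _ => ν) (fun i x => c i * f x) (fun i => hf.const_mul _) _ fun i => ?_
  have := gaussianReal_map_const_mul (μ := 0) (v := v) (c i)
  rw [mul_zero] at this
  rw [← this, ← h, Measure.map_map (measurable_const_mul _) hf]
  rfl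

lemma fourth_moment (v : NNReal) : ∫ x, x ^ 4 ∂(gaussianReal 0 v) = 3 * (v : ℝ) ^ 2 := by
  have h := iteratedDeriv_mgf_zero (X := fun x : ℝ => x) (μ := gaussianReal 0 v)
    (by simp) 4
  rw [mgf_fun_id_gaussianReal] at h
  have he : ∀ t : ℝ, HasDerivAt (fun t : ℝ => Real.exp (0 * t + v * t ^ 2 / 2))
      (v * t * Real.exp (0 * t + v * t ^ 2 / 2)) t := by
    intro t
    have : HasDerivAt (fun t : ℝ => 0 * t + (v : ℝ) * t ^ 2 / 2) (v * t) t := by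
      have := (((hasDerivAt_pow 2 t).const_mul (v : ℝ)).div_const 2).const_add 0
      convert! this using 1
      · ext; simp
      · simp; ring
    convert! this.exp using 1
    ring
  have hp : ∀ (p : ℝ → ℝ) (p' : ℝ → ℝ), (∀ t, HasDerivAt p (p' t) t) →
      deriv (fun t => p t * Real.exp (0 * t + v * t ^ 2 / 2)) =
        fun t => (p' t + v * t * p t) * Real.exp (0 * t + v * t ^ 2 / 2) := by
    intro p p' hp
    ext t
    refine ((hp t).mul (he t)).deriv.trans ?_
    ring
  have e1 : deriv (fun t : ℝ => Real.exp (0 * t + v * t ^ 2 / 2)) =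
      fun t => (v * t) * Real.exp (0 * t + v * t ^ 2 / 2) := by
    ext t; rw [(he t).deriv]
  have d1 : ∀ t : ℝ, HasDerivAt (fun t : ℝ => (v : ℝ) * t) v t := fun t => by
    simpa using (hasDerivAt_id t).const_mul (v : ℝ)
  have d2 : ∀ t : ℝ, HasDerivAt (fun t : ℝ => v + v * t * (v * t)) (2 * (v : ℝ) ^ 2 * t) t :=
    fun t => by
      convert! ((d1 t).mul (d1 t)).const_add (v : ℝ) using 1
      ring
  have d3 : ∀ t : ℝ, HasDerivAt
      (fun t : ℝ => 2 * (v : ℝ) ^ 2 * t + v * t * (v + v * t * (v * t)))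
      (2 * (v : ℝ) ^ 2 + (v * (v + v * t * (v * t)) + v * t * (2 * (v : ℝ) ^ 2 * t))) t :=
    fun t => by
      have := (hasDerivAt_id t).const_mul (2 * (v : ℝ) ^ 2)
      rw [mul_one] at this
      exact this.add ((d1 t).mul (d2 t))
  rw [iteratedDeriv_succ', iteratedDeriv_succ', iteratedDeriv_succ', iteratedDeriv_succ',
    iteratedDeriv_zero, e1, hp _ _ d1, hp _ _ d2, hp _ _ d3] at h
  simp only [Pi.pow_apply] at h
  rw [← h]
  simp
  ring

lemma integrable_fourth (v : NNReal) : Integrable (fun x : ℝ => x ^ 4) (gaussianReal 0 v) :=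
  integrable_pow_of_mem_interior_integrableExpSet (X := fun x : ℝ => x) (by simp) 4

lemma entry_law {q m n t : ℕ} (S : Matrix (Fin q) (Fin m) ℝ) (T : Matrix (Fin n) (Fin t) ℝ)
    (i : Fin q) (j : Fin t) : ∃ v : NNReal,
      (v : ℝ) = (∑ k, S i k ^ 2) * (∑ l, T l j ^ 2) ∧
      (stdGaussianMeasure m n).map (fun g => (S * Matrix.of g * T) i j) = gaussianReal 0 v := by
  have h1 := law_lin (gaussianReal 0 1) (fun x => x) measurable_id 1 (Measure.map_id)
    (fun l => T l j)
  have h2 := law_lin (n := m) (Measure.pi fun _ : Fin n => gaussianReal 0 1)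
    (fun x => ∑ l, T l j * x l) (by fun_prop) _ h1 (fun k => S i k)
  refine ⟨_, ?_, Eq.trans ?_ h2⟩
  · simp [Finset.sum_mul]
  · unfold stdGaussianMeasure
    congr 1
    ext g
    rw [Matrix.mul_assoc]
    simp [Matrix.mul_apply, mul_comm]

/-- Fix real matrices `S ∈ ℝ^{q×m}` and `T ∈ ℝ^{n×t}`, and let `G` be a
standard Gaussian `m×n` random matrix. Then `𝔼[‖S G T‖_F⁴] ≤ 3 ‖S‖_F⁴ ‖T‖_F⁴`
(equivalently, `(𝔼[‖S G T‖_F⁴])^{1/4} ≤ 3^{1/4} ‖S‖_F ‖T‖_F`). -/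
theorem stmt9 {q m n t : ℕ} (S : Matrix (Fin q) (Fin m) ℝ) (T : Matrix (Fin n) (Fin t) ℝ) :
    ∫ g, frobNorm (S * Matrix.of g * T) ^ 4 ∂(stdGaussianMeasure m n) ≤
      3 * frobNorm S ^ 4 * frobNorm T ^ 4 := by
  choose v hv hlaw using fun i j => entry_law S T i j
  have hmeas : ∀ i j, Measurable (fun g : Fin m → Fin n → ℝ => (S * Matrix.of g * T) i j) := by
    intro i j
    simp only [Matrix.mul_apply, Matrix.of_apply]
    fun_prop
  have hint : ∀ i j, Integrable (fun g => (S * Matrix.of g * T) i j ^ 4)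
      (stdGaussianMeasure m n) := by
    intro i j
    have := integrable_fourth (v i j)
    rw [← hlaw i j] at this
    exact this.comp_measurable (hmeas i j)
  have hmom : ∀ i j, ∫ g, (S * Matrix.of g * T) i j ^ 4 ∂(stdGaussianMeasure m n) =
      3 * (v i j : ℝ) ^ 2 := by
    intro i j
    rw [← fourth_moment, ← hlaw i j, integral_map (hmeas i j).aemeasurable (by fun_prop)]
  have hzero : ∀ i j, (v i j : ℝ) = 0 → ∀ g : Fin m → Fin n → ℝ,
      (S * Matrix.of g * T) i j = 0 := by
    intro i j h g
    rw [hv, mul_eq_zero] at h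
    rcases h with h | h
    · rw [Finset.sum_eq_zero_iff_of_nonneg (fun _ _ => sq_nonneg _)] at h
      rw [Matrix.mul_assoc, Matrix.mul_apply]
      exact Finset.sum_eq_zero fun k hk => by simp [pow_eq_zero_iff two_ne_zero |>.1 (h k hk)]
    · rw [Finset.sum_eq_zero_iff_of_nonneg (fun _ _ => sq_nonneg _)] at h
      rw [Matrix.mul_apply]
      exact Finset.sum_eq_zero fun k hk => by simp [pow_eq_zero_iff two_ne_zero |>.1 (h k hk)]
  have hF : ∀ {a b : ℕ} (A : Matrix (Fin a) (Fin b) ℝ),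
      frobNorm A ^ 4 = (∑ i, ∑ j, A i j ^ 2) ^ 2 := by
    intro a b A
    rw [frobNorm, show 4 = 2 * 2 from rfl, pow_mul, Real.sq_sqrt (by positivity)]
  have hV : ∑ p : Fin q × Fin t, (v p.1 p.2 : ℝ) =
      (∑ i, ∑ k, S i k ^ 2) * (∑ l, ∑ j, T l j ^ 2) := by
    simp only [hv, Fintype.sum_prod_type]
    rw [Finset.sum_comm (f := fun l j => T l j ^ 2), Finset.sum_mul_sum]
  have hpt : ∀ g : Fin m → Fin n → ℝ, frobNorm (S * Matrix.of g * T) ^ 4 ≤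
      (∑ p : Fin q × Fin t, (v p.1 p.2 : ℝ)) *
        ∑ p : Fin q × Fin t, (S * Matrix.of g * T) p.1 p.2 ^ 4 / (v p.1 p.2 : ℝ) := by
    intro g
    rw [hF, ← Fintype.sum_prod_type (f := fun p : Fin q × Fin t =>
      (S * Matrix.of g * T) p.1 p.2 ^ 2)]
    refine Finset.sum_sq_le_sum_mul_sum_of_sq_eq_mul _ (fun _ _ => NNReal.coe_nonneg _)
      (fun _ _ => by positivity) fun p _ => ?_
    by_cases h : (v p.1 p.2 : ℝ) = 0
    · simp [hzero _ _ h g, h]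
    · field_simp
  have hi : ∀ p : Fin q × Fin t, Integrable (fun g =>
      (S * Matrix.of g * T) p.1 p.2 ^ 4 / (v p.1 p.2 : ℝ)) (stdGaussianMeasure m n) :=
    fun p => (hint p.1 p.2).div_const _
  calc _ ≤ ∫ g, (∑ p : Fin q × Fin t, (v p.1 p.2 : ℝ)) *
        ∑ p : Fin q × Fin t, (S * Matrix.of g * T) p.1 p.2 ^ 4 / (v p.1 p.2 : ℝ)
          ∂(stdGaussianMeasure m n) := by
        refine integral_mono_of_nonneg (.of_forall fun g => ?_)
          ((integrable_finsetSum _ fun p _ => hi p).const_mul _) (.of_forall hpt)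
        simp only [Pi.zero_apply]
        rw [hF]
        positivity
    _ = (∑ p : Fin q × Fin t, (v p.1 p.2 : ℝ)) * (3 * ∑ p : Fin q × Fin t, (v p.1 p.2 : ℝ)) := by
        rw [integral_const_mul, integral_finsetSum _ fun p _ => hi p, Finset.mul_sum (a := 3)]
        congr 1
        refine Finset.sum_congr rfl fun p _ => ?_
        rw [integral_div, hmom]
        by_cases h : (v p.1 p.2 : ℝ) = 0
        · simp [h]
        · field_simp
    _ = _ := by
        rw [hV, hF, hF]
        ring
end

section
/- Let s ∈ ℝ^m and t ∈ ℝ^n, let S = diag(s) ∈ ℝ^{m×m} and T = diag(t) ∈ ℝ^{n×n} be the corresponding diagonal matrices, and let G be a standard Gaussian m×n random matrix. Then 𝔼[‖S G T‖_F⁴] = (∑_{j=1}^m s_j²)² (∑_{k=1}^n t_k²)² + 2 (∑_{j=1}^m s_j⁴)(∑_{k=1}^n t_k⁴), i.e. 𝔼[‖S G T‖_F⁴] = ‖S‖_F⁴ ‖T‖_F⁴ + 2 (∑_j s_j⁴)(∑_k t_k⁴); in particular 𝔼[‖S G T‖_F⁴] ≤ 3 ‖S‖_F⁴ ‖T‖_F⁴.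 -/
open MeasureTheory ProbabilityTheory Matrix

lemma gauss_sq : ∫ x, x ^ 2 ∂(gaussianReal 0 1) = 1 := by
  have h := variance_eq_sub (μ := gaussianReal 0 1) (X := id) (memLp_id_gaussianReal 2)
  rw [variance_id_gaussianReal] at h
  simp at h
  linarith

lemma hasDerivAt_gexp (x : ℝ) :
    HasDerivAt (fun t : ℝ => Real.exp (t ^ 2 / 2)) (x * Real.exp (x ^ 2 / 2)) x := by
  have h : HasDerivAt (fun t : ℝ => t ^ 2 / 2) x x := by
    refine ((hasDerivAt_pow 2 x).div_const 2).congr_deriv ?_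
    norm_num
  convert h.exp using 1
  ring

lemma gauss_four : ∫ x, x ^ 4 ∂(gaussianReal 0 1) = 3 := by
  have h0 : (0 : ℝ) ∈ interior (integrableExpSet id (gaussianReal 0 1)) := by
    rw [integrableExpSet_id_gaussianReal]; simp
  have h := iteratedDeriv_mgf_zero h0 4
  have hm : mgf id (gaussianReal 0 1) = fun t => Real.exp (t ^ 2 / 2) := by
    rw [mgf_id_gaussianReal]; simp
  have d1 : deriv (fun t : ℝ => Real.exp (t ^ 2 / 2)) = fun t => t * Real.exp (t ^ 2 / 2) :=
    funext fun x => (hasDerivAt_gexp x).deriv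
  have d2 : deriv (fun t : ℝ => t * Real.exp (t ^ 2 / 2))
      = fun t => (t ^ 2 + 1) * Real.exp (t ^ 2 / 2) := by
    funext x
    refine (((hasDerivAt_id x).mul (hasDerivAt_gexp x)).congr_deriv ?_).deriv
    simp; ring
  have d3 : deriv (fun t : ℝ => (t ^ 2 + 1) * Real.exp (t ^ 2 / 2))
      = fun t => (t ^ 3 + 3 * t) * Real.exp (t ^ 2 / 2) := by
    funext x
    refine ((((hasDerivAt_pow 2 x).add_const 1).mul (hasDerivAt_gexp x)).congr_deriv ?_).deriv
    simp; ring
  have d4 : deriv (fun t : ℝ => (t ^ 3 + 3 * t) * Real.exp (t ^ 2 / 2))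
      = fun t => (t ^ 4 + 6 * t ^ 2 + 3) * Real.exp (t ^ 2 / 2) := by
    funext x
    refine ((((hasDerivAt_pow 3 x).add ((hasDerivAt_id x).const_mul 3)).mul
      (hasDerivAt_gexp x)).congr_deriv ?_).deriv
    simp; ring
  rw [hm] at h
  simp only [iteratedDeriv_succ, iteratedDeriv_zero, d1, d2, d3, d4] at h
  simp at h
  linarith

/-- Second moment of a sum of independent variables on a product space. -/
lemma pi_sum_moment {ι : Type*} [Fintype ι] {Ω : Type*} [MeasurableSpace Ω] (μ : Measure Ω)
    [IsProbabilityMeasure μ] (c : ι → ℝ) (f : Ω → ℝ) (hf : MemLp f 2 μ) :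
    MemLp (fun ω : ι → Ω => ∑ i, c i * f (ω i)) 2 (Measure.pi fun _ => μ) ∧
    (∫ ω, (∑ i, c i * f (ω i)) ∂(Measure.pi fun _ : ι => μ) = (∑ i, c i) * ∫ x, f x ∂μ) ∧
    Var[fun ω : ι → Ω => ∑ i, c i * f (ω i); Measure.pi fun _ => μ]
      = (∑ i, c i ^ 2) * Var[f; μ] := by
  have hm : ∀ i, MemLp (fun ω : ι → Ω => c i * f (ω i)) 2 (Measure.pi fun _ => μ) := fun i =>
    (hf.comp_measurePreserving (measurePreserving_eval (fun _ : ι => μ) i)).const_mul (c i)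
  refine ⟨memLp_finsetSum _ fun i _ => hm i, ?_, ?_⟩
  · rw [integral_finsetSum _ fun i _ => (hm i).integrable (by norm_num), Finset.sum_mul]
    refine Finset.sum_congr rfl fun i _ => ?_
    rw [integral_const_mul]
    congr 1
    exact integral_comp_eval (μ := fun _ : ι => μ) hf.aestronglyMeasurable
  · have h := variance_sum_pi (μ := fun _ : ι => μ) (X := fun i x => c i * f x)
      (fun i => hf.const_mul (c i))
    have e : (fun ω : ι → Ω => ∑ i, c i * f (ω i)) = ∑ i, fun ω : ι → Ω => c i * f (ω i) := by
      funext ω; simp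
    rw [e, h, Finset.sum_mul]
    exact Finset.sum_congr rfl fun i _ => variance_const_mul _ _ _

lemma frob_pow_four {m n : ℕ} (s : Fin m → ℝ) (t : Fin n → ℝ) (g : Fin m → Fin n → ℝ) :
    frobNorm (Matrix.diagonal s * Matrix.of g * Matrix.diagonal t) ^ 4
      = (∑ i, s i ^ 2 * ∑ k, t k ^ 2 * g i k ^ 2) ^ 2 := by
  unfold frobNorm
  rw [show 4 = 2 * 2 from rfl, pow_mul, Real.sq_sqrt (by positivity)]
  congr 1
  refine Finset.sum_congr rfl fun i _ => ?_
  rw [Finset.mul_sum]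
  refine Finset.sum_congr rfl fun k _ => ?_
  rw [Matrix.mul_diagonal, Matrix.diagonal_mul, Matrix.of_apply]
  ring

lemma frob_diag {m : ℕ} (s : Fin m → ℝ) :
    frobNorm (Matrix.diagonal s) ^ 4 = (∑ i, s i ^ 2) ^ 2 := by
  unfold frobNorm
  rw [show 4 = 2 * 2 from rfl, pow_mul, Real.sq_sqrt (by positivity)]
  congr 1
  refine Finset.sum_congr rfl fun i _ => ?_
  rw [Finset.sum_eq_single i] <;> simp +contextual [eq_comm]

lemma sum_four_le {m : ℕ} (s : Fin m → ℝ) : ∑ i, s i ^ 4 ≤ (∑ i, s i ^ 2) ^ 2 := by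
  have := Finset.sum_sq_le_sq_sum_of_nonneg (s := Finset.univ) (f := fun i => s i ^ 2)
    (fun i _ => sq_nonneg _)
  simpa [← pow_mul] using this

/-- Let `s ∈ ℝ^m`, `t ∈ ℝ^n`, `S = diag(s)`, `T = diag(t)`, and let `G`
be a standard Gaussian `m×n` random matrix. Then
`𝔼[‖S G T‖_F⁴] = (∑ⱼ sⱼ²)² (∑ₖ tₖ²)² + 2 (∑ⱼ sⱼ⁴)(∑ₖ tₖ⁴)`;
in particular `𝔼[‖S G T‖_F⁴] ≤ 3 ‖S‖_F⁴ ‖T‖_F⁴`. -/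
theorem stmt11 {m n : ℕ} (s : Fin m → ℝ) (t : Fin n → ℝ) :
    (∫ g, frobNorm (Matrix.diagonal s * Matrix.of g * Matrix.diagonal t) ^ 4
        ∂(stdGaussianMeasure m n) =
      (∑ j, s j ^ 2) ^ 2 * (∑ k, t k ^ 2) ^ 2 + 2 * (∑ j, s j ^ 4) * (∑ k, t k ^ 4)) ∧
    (∫ g, frobNorm (Matrix.diagonal s * Matrix.of g * Matrix.diagonal t) ^ 4
        ∂(stdGaussianMeasure m n) ≤
      3 * frobNorm (Matrix.diagonal s) ^ 4 * frobNorm (Matrix.diagonal t) ^ 4) := by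
  have key : ∫ g, frobNorm (Matrix.diagonal s * Matrix.of g * Matrix.diagonal t) ^ 4
        ∂(stdGaussianMeasure m n) =
      (∑ j, s j ^ 2) ^ 2 * (∑ k, t k ^ 2) ^ 2 + 2 * (∑ j, s j ^ 4) * (∑ k, t k ^ 4) := by
    have hf : MemLp (fun x : ℝ => x ^ 2) 2 (gaussianReal 0 1) := by
      rw [memLp_two_iff_integrable_sq (by fun_prop)]
      have := (memLp_id_gaussianReal (μ := 0) (v := 1) 4).integrable_norm_pow (by norm_num)
      refine this.congr (Filter.Eventually.of_forall fun x => ?_)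
      simp only [id, Real.norm_eq_abs]
      rw [Even.pow_abs (by decide)]
      ring
    have hv : Var[fun x : ℝ => x ^ 2; gaussianReal 0 1] = 2 := by
      rw [variance_eq_sub hf]
      have : ∫ x, ((fun x : ℝ => x ^ 2) ^ 2) x ∂(gaussianReal 0 1) = 3 := by
        rw [← gauss_four]
        congr 1
        funext x
        simp only [Pi.pow_apply]
        ring
      rw [this, gauss_sq]
      norm_num
    obtain ⟨a1, a2, a3⟩ := pi_sum_moment (gaussianReal 0 1) (fun k => t k ^ 2) _ hf
    obtain ⟨b1, b2, b3⟩ := pi_sum_moment (Measure.pi fun _ : Fin n => gaussianReal 0 1)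
      (fun k => s k ^ 2) _ a1
    rw [a2, gauss_sq] at b2
    rw [a3, hv, variance_eq_sub b1, b2] at b3
    simp_rw [frob_pow_four]
    simp only [Pi.pow_apply, ← pow_mul] at b3
    norm_num at b3
    unfold stdGaussianMeasure
    linarith
  refine ⟨key, ?_⟩
  rw [key, frob_diag, frob_diag]
  have h := mul_le_mul (sum_four_le s) (sum_four_le t) (by positivity) (by positivity)
  nlinarith [h]
end
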